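/- Let m and n be coprime squarefree positive integers none of whose prime divisors is congruent to 3 modulo 4, with mn > 1. Assume that (n/p) = 1 for every prime p dividing m, that (m/q) = 1 for every prime q dividing n, and that ∏_{p ∣ m} (n/p)₄ · ∏_{q ∣ n} (m/q)₄ = −1. Then the negative Pell equation x² − mn·y² = −1 has no solution in integers x, y (equivalently, the fundamental unit of ℚ(√(mn)) has norm +1). -/

import Mathlib

open scoped Classical in
noncomputable def legSym (a : ℤ) (p : ℕ) : ℤ :=
  if p = 2 then (if a % 8 = 1 ∨ a % 8 = 7 then 1 else -1)
  else if ∃ x : ℤ, (p : ℤ) ∣ (x ^ 2 - a) then 1 else -1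

open scoped Classical in
noncomputable def quartSym (a : ℤ) (p : ℕ) : ℤ :=
  if p = 2 then (if a % 16 = 1 ∨ a % 16 = 15 then 1 else -1)
  else if ∃ x : ℤ, (p : ℤ) ∣ (x ^ 4 - a) then 1 else -1

open scoped NumberTheorySymbols

/-- The Chinese remainder theorem for finitely many primes. -/
lemma exists_dvd_sub_of_primes (s : Finset ℕ) (hs : ∀ p ∈ s, p.Prime) (f : ℕ → ℤ) :
    ∃ r : ℤ, ∀ p ∈ s, (p : ℤ) ∣ r - f p := by
  obtain ⟨k, hk⟩ := Nat.chineseRemainderOfFinset (fun p => (f p % p).toNat) id s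
    (fun p hp => (hs p hp).ne_zero)
    (fun p hp q hq hpq => (Nat.coprime_primes (hs p hp) (hs q hq)).2 hpq)
  refine ⟨k, fun p hp => ?_⟩
  have h := (Nat.modEq_iff_dvd.1 (hk p hp).symm)
  have hp0 : (p : ℤ) ≠ 0 := by exact_mod_cast (hs p hp).ne_zero
  simp only [id] at h
  rw [Int.toNat_of_nonneg (Int.emod_nonneg _ hp0)] at h
  have h2 : (p : ℤ) ∣ f p - f p % p := Int.dvd_self_sub_emod
  have := dvd_sub h h2
  simpa using this

lemma exists_dvd_sq_sub {m : ℕ} (hm : Squarefree m) (a : ℤ)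
    (h : ∀ p ∈ m.primeFactors, ∃ x : ℤ, (p : ℤ) ∣ x ^ 2 - a) :
    ∃ x : ℤ, (m : ℤ) ∣ x ^ 2 - a := by
  choose! f hf using h
  obtain ⟨r, hr⟩ := exists_dvd_sub_of_primes m.primeFactors
    (fun p hp => Nat.prime_of_mem_primeFactors hp) f
  refine ⟨r, ?_⟩
  rw [← Nat.prod_primeFactors_of_squarefree hm, Nat.cast_prod]
  refine Finset.prod_dvd_of_coprime (fun p hp q hq hpq => ?_) (fun p hp => ?_)
  · exact Nat.isCoprime_iff_coprime.2 ((Nat.coprime_primes (Nat.prime_of_mem_primeFactors hp)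
      (Nat.prime_of_mem_primeFactors hq)).2 hpq)
  · have e : r ^ 2 - a = (r - f p) * (r + f p) + (f p ^ 2 - a) := by ring
    rw [e]
    exact dvd_add (Dvd.dvd.mul_right (hr p hp) _) (hf p hp)

/-- A squarefree number greater than `1` is not a square, so its integer square root is strict. -/
lemma sqrt_sq_lt_of_squarefree {m : ℕ} (hm : Squarefree m) (h1 : 1 < m) : m.sqrt ^ 2 < m := by
  refine lt_of_le_of_ne (Nat.sqrt_le' m) fun h => ?_
  have := hm m.sqrt ⟨1, by rw [mul_one, ← sq, h]⟩
  rw [Nat.isUnit_iff] at this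
  rw [this] at h
  omega

lemma sq_sub_le_of_mem_range {k a b : ℕ} (ha : a ∈ Finset.range (k + 1))
    (hb : b ∈ Finset.range (k + 1)) : ((a : ℤ) - b) ^ 2 ≤ (k : ℤ) ^ 2 := by
  simp only [Finset.mem_range] at ha hb
  apply sq_le_sq.2
  rw [abs_le, abs_of_nonneg (by positivity)]
  constructor <;> omega

/-- Thue's lemma: a square root of `-1` modulo `m` yields `m` as a compatible sum of two squares. -/
lemma exists_sq_add_sq_of_dvd {m : ℕ} (hm : Squarefree m) (x : ℤ) (hx : (m : ℤ) ∣ x ^ 2 + 1) :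
    ∃ a b : ℤ, a ^ 2 + b ^ 2 = m ∧ (m : ℤ) ∣ a + b * x := by
  rcases Nat.lt_or_ge 1 m with h1 | h1
  swap
  · obtain rfl : m = 1 := by have := hm.ne_zero; omega
    exact ⟨1, 0, by simp, by simp⟩
  have : NeZero m := ⟨by omega⟩
  set k := m.sqrt
  have hk : k ^ 2 < m := sqrt_sq_lt_of_squarefree hm h1
  have hk' : m < (k + 1) * (k + 1) := Nat.lt_succ_sqrt m
  obtain ⟨⟨a, b⟩, hs, ⟨a', b'⟩, hs', hne, he⟩ :=
    Finset.exists_ne_map_eq_of_card_lt_of_maps_to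
      (s := Finset.range (k + 1) ×ˢ Finset.range (k + 1)) (t := (Finset.univ : Finset (ZMod m)))
      (f := fun v => ((v.1 + v.2 * x : ℤ) : ZMod m)) (by simpa [ZMod.card] using hk') (by simp)
  simp only [Finset.mem_product] at hs hs'
  have h2 := (ZMod.intCast_eq_intCast_iff_dvd_sub _ _ _).1 he.symm
  have hd : (m : ℤ) ∣ ((a : ℤ) - a') + ((b : ℤ) - b') * x := by
    convert h2 using 1; ring
  refine ⟨(a : ℤ) - a', (b : ℤ) - b', ?_, hd⟩
  have hA := sq_sub_le_of_mem_range hs.1 hs'.1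
  have hB := sq_sub_le_of_mem_range hs.2 hs'.2
  have hpos : 0 < ((a : ℤ) - a') ^ 2 + ((b : ℤ) - b') ^ 2 := by
    by_contra hcon
    have e1 : (a : ℤ) - a' = 0 := by nlinarith [sq_nonneg ((a : ℤ) - a'), sq_nonneg ((b : ℤ) - b')]
    have e2 : (b : ℤ) - b' = 0 := by nlinarith [sq_nonneg ((a : ℤ) - a'), sq_nonneg ((b : ℤ) - b')]
    exact hne (Prod.ext (by simp; omega) (by simp; omega))
  generalize (a : ℤ) - a' = A at *
  generalize (b : ℤ) - b' = B at *
  have hdv : (m : ℤ) ∣ A ^ 2 + B ^ 2 := by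
    have e : A ^ 2 + B ^ 2 = (A + B * x) * (A - B * x) + B ^ 2 * (x ^ 2 + 1) := by ring
    rw [e]
    exact dvd_add (hd.mul_right _) (hx.mul_left _)
  obtain ⟨c, hc⟩ := hdv
  have hkz : (k : ℤ) ^ 2 < m := by exact_mod_cast hk
  have hm0 : (0 : ℤ) < m := by exact_mod_cast (by omega : 0 < m)
  have c1 : 0 < c := by nlinarith
  have c2 : c < 2 := by nlinarith
  obtain rfl : c = 1 := by omega
  rw [hc, mul_one]

/-- Legendre's theorem for `X² = mZ² + nY²`. -/
lemma exists_legendre_solution {m n : ℕ} (hm : Squarefree m) (hn : Squarefree n)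
    (hco : m.Coprime n) (s t : ℤ) (hs : (m : ℤ) ∣ s ^ 2 - n) (ht : (n : ℤ) ∣ t ^ 2 - m) :
    ∃ X Y Z : ℤ, X ≠ 0 ∧ X ^ 2 = m * Z ^ 2 + n * Y ^ 2 := by
  rcases Nat.lt_or_ge 1 n with h1 | h1
  swap
  · obtain rfl : n = 1 := by have := hn.ne_zero; omega
    exact ⟨1, 1, 0, by simp, by simp⟩
  rcases Nat.lt_or_ge 1 m with h1' | h1'
  swap
  · obtain rfl : m = 1 := by have := hm.ne_zero; omega
    exact ⟨1, 0, 1, by simp, by simp⟩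
  have : NeZero m := ⟨by omega⟩
  have : NeZero n := ⟨by omega⟩
  have hmn : Squarefree (m * n) := (Nat.squarefree_mul hco).2 ⟨hm, hn⟩
  set k := (m * n).sqrt
  set k₁ := m.sqrt
  set k₂ := n.sqrt
  have hk : k ^ 2 < m * n := sqrt_sq_lt_of_squarefree hmn (by nlinarith)
  have hk₁ : k₁ ^ 2 < m := sqrt_sq_lt_of_squarefree hm h1'
  have hk₂ : k₂ ^ 2 < n := sqrt_sq_lt_of_squarefree hn h1
  have gk : m * n < (k + 1) ^ 2 := Nat.lt_succ_sqrt' _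
  have gk₁ : m < (k₁ + 1) ^ 2 := Nat.lt_succ_sqrt' m
  have gk₂ : n < (k₂ + 1) ^ 2 := Nat.lt_succ_sqrt' n
  have hcard : m * n < (k + 1) * ((k₁ + 1) * (k₂ + 1)) := by
    refine lt_of_pow_lt_pow_left₀ 2 (by positivity) ?_
    calc (m * n) ^ 2 = (m * n) * (m * n) := by ring
      _ < (k + 1) ^ 2 * ((k₁ + 1) ^ 2 * (k₂ + 1) ^ 2) := by gcongr
      _ = _ := by ring
  obtain ⟨⟨a, b, c⟩, hs1, ⟨a', b', c'⟩, hs', hne, he⟩ :=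
    Finset.exists_ne_map_eq_of_card_lt_of_maps_to
      (s := Finset.range (k + 1) ×ˢ Finset.range (k₁ + 1) ×ˢ Finset.range (k₂ + 1))
      (t := (Finset.univ : Finset (ZMod m × ZMod n)))
      (f := fun v => (((v.1 - v.2.1 * s : ℤ) : ZMod m), ((v.1 - v.2.2 * t : ℤ) : ZMod n)))
      (by simpa [ZMod.card] using hcard) (by simp)
  simp only [Finset.mem_product] at hs1 hs'
  obtain ⟨he1, he2⟩ := Prod.mk.inj he
  have hd1 : (m : ℤ) ∣ ((a : ℤ) - a') - ((b : ℤ) - b') * s := by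
    convert (ZMod.intCast_eq_intCast_iff_dvd_sub _ _ _).1 he1.symm using 1; ring
  have hd2 : (n : ℤ) ∣ ((a : ℤ) - a') - ((c : ℤ) - c') * t := by
    convert (ZMod.intCast_eq_intCast_iff_dvd_sub _ _ _).1 he2.symm using 1; ring
  have hA := sq_sub_le_of_mem_range hs1.1 hs'.1
  have hB := sq_sub_le_of_mem_range hs1.2.1 hs'.2.1
  have hC := sq_sub_le_of_mem_range hs1.2.2 hs'.2.2
  have hnz : ¬ ((a : ℤ) - a' = 0 ∧ (b : ℤ) - b' = 0 ∧ (c : ℤ) - c' = 0) := by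
    rintro ⟨e1, e2, e3⟩
    exact hne (Prod.ext (by simp; omega) (Prod.ext (by simp; omega) (by simp; omega)))
  generalize (a : ℤ) - a' = A at *
  generalize (b : ℤ) - b' = B at *
  generalize (c : ℤ) - c' = C at *
  have hdm : (m : ℤ) ∣ A ^ 2 - n * B ^ 2 - m * C ^ 2 := by
    have e : A ^ 2 - n * B ^ 2 - m * C ^ 2 =
      (A - B * s) * (A + B * s) + B ^ 2 * (s ^ 2 - n) - m * C ^ 2 := by ring
    rw [e]
    exact dvd_sub (dvd_add (hd1.mul_right _) (hs.mul_left _)) (dvd_mul_right _ _)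
  have hdn : (n : ℤ) ∣ A ^ 2 - n * B ^ 2 - m * C ^ 2 := by
    have e : A ^ 2 - n * B ^ 2 - m * C ^ 2 =
      (A - C * t) * (A + C * t) + C ^ 2 * (t ^ 2 - m) - n * B ^ 2 := by ring
    rw [e]
    exact dvd_sub (dvd_add (hd2.mul_right _) (ht.mul_left _)) (dvd_mul_right _ _)
  obtain ⟨d, hd⟩ := (Nat.isCoprime_iff_coprime.2 hco).mul_dvd hdm hdn
  have zk : (k : ℤ) ^ 2 < m * n := by exact_mod_cast hk
  have zk₁ : (k₁ : ℤ) ^ 2 < m := by exact_mod_cast hk₁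
  have zk₂ : (k₂ : ℤ) ^ 2 < n := by exact_mod_cast hk₂
  have hm0 : (0 : ℤ) < m := by exact_mod_cast (by omega : 0 < m)
  have hn0 : (0 : ℤ) < n := by exact_mod_cast (by omega : 0 < n)
  have hmn0 : (0 : ℤ) < m * n := by positivity
  have hB' : n * B ^ 2 < n * (m : ℤ) := by gcongr; omega
  have hC' : m * C ^ 2 < m * (n : ℤ) := by gcongr; omega
  have nB : 0 ≤ n * B ^ 2 := by positivity
  have nC : 0 ≤ m * C ^ 2 := by positivity
  have d1 : d < 1 := by
    have : (m * n : ℤ) * d < m * n * 1 := by linarith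
    exact lt_of_mul_lt_mul_left this hmn0.le
  have d2 : -2 < d := by
    have : (m * n : ℤ) * (-2) < m * n * d := by linarith [sq_nonneg A]
    exact lt_of_mul_lt_mul_left this hmn0.le
  obtain rfl | rfl : d = 0 ∨ d = -1 := by omega
  · refine ⟨A, B, C, ?_, by linarith⟩
    rintro rfl
    refine hnz ⟨rfl, ?_, ?_⟩
    · have : n * B ^ 2 = 0 := by linarith
      simpa [NeZero.ne n] using this
    · have : m * C ^ 2 = 0 := by linarith
      simpa [NeZero.ne m] using this
  · have key : (A * C + n * B) ^ 2 = m * (C ^ 2 - n) ^ 2 + n * (A + B * C) ^ 2 := by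
      linear_combination (C ^ 2 - n) * hd
    refine ⟨_, _, _, ?_, key⟩
    intro h0
    rw [h0] at key
    have : 0 < m * (C ^ 2 - n) ^ 2 := by
      have : C ^ 2 - n ≠ 0 := by omega
      positivity
    have : 0 ≤ n * (A + B * C) ^ 2 := by positivity
    linarith

lemma dvd_of_sq_dvd_mul_sq {m Z p : ℕ} (hm : Squarefree m) (hp : p.Prime)
    (h : p ^ 2 ∣ m * Z ^ 2) : p ∣ Z := by
  by_contra hZ
  have hc : Nat.Coprime (p ^ 2) (Z ^ 2) := Nat.Coprime.pow 2 2 ((hp.coprime_iff_not_dvd).2 hZ)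
  have h2 := hc.dvd_of_dvd_mul_right h
  have := hm p (by rwa [← sq])
  exact hp.one_lt.ne' (Nat.isUnit_iff.1 this)

/-- A solution of `X² = mZ² + nY²` in positive integers without redundant common factors. -/
structure PrimitiveSolution (m n X Y Z : ℕ) : Prop where
  eq : X ^ 2 = m * Z ^ 2 + n * Y ^ 2
  coprime_XY : X.Coprime Y
  coprime_XZ : X.Coprime Z
  coprime_Xm : X.Coprime m
  coprime_Xn : X.Coprime n
  coprime_Ym : Y.Coprime m
  coprime_Zn : Z.Coprime n
  X_pos : 0 < X

lemma PrimitiveSolution.swap {m n X Y Z : ℕ} (h : PrimitiveSolution m n X Y Z) :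
    PrimitiveSolution n m X Z Y :=
  ⟨by rw [h.eq, add_comm], h.coprime_XZ, h.coprime_XY, h.coprime_Xn, h.coprime_Xm,
    h.coprime_Zn, h.coprime_Ym, h.X_pos⟩

lemma exists_primitiveSolution {m n : ℕ} (hm : Squarefree m) (hn : Squarefree n)
    (hco : m.Coprime n) (hex : ∃ X Y Z : ℤ, X ≠ 0 ∧ X ^ 2 = m * Z ^ 2 + n * Y ^ 2) :
    ∃ X Y Z : ℕ, PrimitiveSolution m n X Y Z := by
  have hex' : ∃ X : ℕ, 0 < X ∧ ∃ Y Z : ℕ, X ^ 2 = m * Z ^ 2 + n * Y ^ 2 := by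
    obtain ⟨X, Y, Z, h0, h⟩ := hex
    refine ⟨X.natAbs, Int.natAbs_pos.2 h0, Y.natAbs, Z.natAbs, ?_⟩
    zify
    simpa only [sq_abs] using h
  classical
  obtain ⟨hX0, Y, Z, h⟩ := Nat.find_spec hex'
  have hmin := fun k => Nat.find_min hex' (m := k)
  generalize Nat.find hex' = X at *
  have hprim : ∀ p : ℕ, p.Prime → p ∣ X → p ∣ Y → p ∣ Z → False := by
    rintro p hp ⟨X', rfl⟩ ⟨Y', rfl⟩ ⟨Z', rfl⟩
    have hX' : 0 < X' := Nat.pos_of_mul_pos_left hX0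
    refine hmin X' (by nlinarith [hp.one_lt]) ⟨hX', Y', Z', ?_⟩
    have : p ^ 2 * X' ^ 2 = p ^ 2 * (m * Z' ^ 2 + n * Y' ^ 2) := by linarith
    exact Nat.eq_of_mul_eq_mul_left (pow_pos hp.pos 2) this
  have cXY : ∀ p : ℕ, p.Prime → p ∣ X → p ∣ Y → False := fun p hp h1 h2 =>
    hprim p hp h1 h2 (dvd_of_sq_dvd_mul_sq hm hp ((Nat.dvd_add_left
      ((pow_dvd_pow_of_dvd h2 2).mul_left n)).1 (h ▸ pow_dvd_pow_of_dvd h1 2)))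
  have cXZ : ∀ p : ℕ, p.Prime → p ∣ X → p ∣ Z → False := fun p hp h1 h2 =>
    hprim p hp h1 (dvd_of_sq_dvd_mul_sq hn hp ((Nat.dvd_add_right
      ((pow_dvd_pow_of_dvd h2 2).mul_left m)).1 (h ▸ pow_dvd_pow_of_dvd h1 2))) h2
  have cmn : ∀ p : ℕ, p.Prime → p ∣ m → p ∣ n → False := fun p hp h1 h2 =>
    Nat.not_coprime_of_dvd_of_dvd hp.one_lt h1 h2 hco
  have cXm : ∀ p : ℕ, p.Prime → p ∣ X → p ∣ m → False := fun p hp h1 h2 => by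
    have h3 : p ∣ n * Y ^ 2 := (Nat.dvd_add_right (h2.mul_right (Z ^ 2))).1
      (h ▸ dvd_pow h1 two_ne_zero)
    rcases hp.dvd_mul.1 h3 with h4 | h4
    · exact cmn p hp h2 h4
    · exact cXY p hp h1 (hp.dvd_of_dvd_pow h4)
  have cXn : ∀ p : ℕ, p.Prime → p ∣ X → p ∣ n → False := fun p hp h1 h2 => by
    have h3 : p ∣ m * Z ^ 2 := (Nat.dvd_add_left (h2.mul_right (Y ^ 2))).1
      (h ▸ dvd_pow h1 two_ne_zero)
    rcases hp.dvd_mul.1 h3 with h4 | h4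
    · exact cmn p hp h4 h2
    · exact cXZ p hp h1 (hp.dvd_of_dvd_pow h4)
  refine ⟨X, Y, Z, h, Nat.coprime_of_dvd fun p hp h1 h2 => cXY p hp h1 h2,
    Nat.coprime_of_dvd fun p hp h1 h2 => cXZ p hp h1 h2,
    Nat.coprime_of_dvd fun p hp h1 h2 => cXm p hp h1 h2,
    Nat.coprime_of_dvd fun p hp h1 h2 => cXn p hp h1 h2,
    Nat.coprime_of_dvd fun p hp h1 h2 => cXm p hp ?_ h2,
    Nat.coprime_of_dvd fun p hp h1 h2 => cXn p hp ?_ h2, hX0⟩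
  · refine hp.dvd_of_dvd_pow (n := 2) ?_
    rw [h]
    exact dvd_add (h2.mul_right _) ((dvd_pow h1 two_ne_zero).mul_left _)
  · refine hp.dvd_of_dvd_pow (n := 2) ?_
    rw [h]
    exact dvd_add ((dvd_pow h1 two_ne_zero).mul_left _) (h2.mul_right _)

/-- `J(a | n) = 1` as soon as `x² = ay²` has a nonzero solution modulo every prime divisor. -/
lemma jacobiSym_eq_one {a : ℤ} {n : ℕ} (hc : a.gcd n = 1)
    (h : ∀ p : ℕ, p.Prime → p ∣ n →
      ∃ x y : ℤ, (p : ℤ) ∣ x ^ 2 - a * y ^ 2 ∧ ¬ ((p : ℤ) ∣ x ∧ (p : ℤ) ∣ y)) :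
    J(a | n) = 1 := by
  refine (jacobiSym.eq_one_or_neg_one hc).resolve_right fun hneg => ?_
  obtain ⟨p, hp, hpn, hj⟩ := jacobiSym.eq_neg_one_at_prime_divisor_of_eq_neg_one hneg
  obtain ⟨x, y, hxy, hnot⟩ := h p hp hpn
  have : Fact p.Prime := ⟨hp⟩
  exact hnot (jacobiSym.prime_dvd_of_eq_neg_one hj hxy)

lemma jacobiSym_finset_prod_right (a : ℤ) (s : Finset ℕ) (hs : ∀ p ∈ s, p ≠ 0) :
    J(a | ∏ p ∈ s, p) = ∏ p ∈ s, J(a | p) := by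
  induction s using Finset.induction_on with
  | empty => simp
  | insert p s hps ih =>
    have hs' : ∀ q ∈ s, q ≠ 0 := fun q hq => hs q (Finset.mem_insert_of_mem hq)
    rw [Finset.prod_insert hps, Finset.prod_insert hps,
      jacobiSym.mul_right' _ (hs p (Finset.mem_insert_self _ _)) (Finset.prod_ne_zero_iff.2 hs'),
      ih hs']

lemma jacobiSym_eq_prod_primeFactors (a : ℤ) {n : ℕ} (hn : Squarefree n) :
    J(a | n) = ∏ p ∈ n.primeFactors, J(a | p) := by
  conv_lhs => rw [← Nat.prod_primeFactors_of_squarefree hn]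
  exact jacobiSym_finset_prod_right a _ fun p hp => (Nat.prime_of_mem_primeFactors hp).ne_zero

/-- The quartic symbol of `a = (X/Z)²` is the quadratic symbol of `XZ` when `-1` is a square. -/
lemma quartSym_eq_jacobiSym {q : ℕ} (hq : q.Prime) (hq2 : q ≠ 2) {a X Z x : ℤ}
    (hx : (q : ℤ) ∣ x ^ 2 + 1) (h : (q : ℤ) ∣ X ^ 2 - a * Z ^ 2)
    (hX : ¬ (q : ℤ) ∣ X) (hZ : ¬ (q : ℤ) ∣ Z) : quartSym a q = J(X * Z | q) := by
  have : Fact q.Prime := ⟨hq⟩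
  have cast0 : ∀ t : ℤ, (q : ℤ) ∣ t ↔ (t : ZMod q) = 0 := fun t =>
    (ZMod.intCast_zmod_eq_zero_iff_dvd t q).symm
  rw [cast0] at hx h hX hZ
  push_cast at hx h
  have hXZ : ((X * Z : ℤ) : ZMod q) ≠ 0 := by push_cast; exact mul_ne_zero hX hZ
  rw [← jacobiSym.legendreSym.to_jacobiSym]
  rw [quartSym, if_neg hq2]
  split_ifs with hr
  · obtain ⟨r, hr⟩ := hr
    rw [cast0] at hr
    push_cast at hr
    symm
    rw [legendreSym.eq_one_iff q hXZ]
    have : ((X : ZMod q) - r ^ 2 * Z) * (X + r ^ 2 * Z) = 0 := by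
      linear_combination h - Z ^ 2 * hr
    push_cast
    rcases mul_eq_zero.1 this with h1 | h1
    · exact ⟨r * Z, by linear_combination Z * h1⟩
    · exact ⟨x * r * Z, by linear_combination Z * h1 - r ^ 2 * Z ^ 2 * hx⟩
  · symm
    refine (legendreSym.eq_neg_one_iff q).2 fun hsq => hr ?_
    obtain ⟨w, hw⟩ := hsq
    push_cast at hw
    obtain ⟨r, hrr⟩ := ZMod.intCast_surjective (w / Z : ZMod q)
    refine ⟨r, ?_⟩
    rw [cast0]
    push_cast
    rw [hrr]
    field_simp
    linear_combination (-(w ^ 2) - X * Z) * hw + Z ^ 2 * h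

lemma mod_four_eq_one_of_dvd {n : ℕ} (hn : Odd n) {x : ℤ} (hx : (n : ℤ) ∣ x ^ 2 + 1) :
    n % 4 = 1 := by
  have h1 : J(-1 | n) = 1 := by
    refine jacobiSym_eq_one (by simp) fun p hp hpn => ⟨x, 1, ?_, fun hh => ?_⟩
    · rw [show x ^ 2 - (-1) * 1 ^ 2 = x ^ 2 + 1 by ring]
      exact (Int.natCast_dvd_natCast.2 hpn).trans hx
    · exact hp.one_lt.ne' (Nat.dvd_one.1 (by exact_mod_cast hh.2))
  rw [jacobiSym.at_neg_one hn] at h1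
  rcases Nat.odd_mod_four_iff.1 (Nat.odd_iff.1 hn) with h | h
  · exact h
  · rw [ZMod.χ₄_nat_three_mod_four h] at h1
    norm_num at h1

/-- If `n` is a square modulo the prime divisors of `Z`, then `J(Z | n)` only depends on the
power of two dividing `Z`. -/
lemma jacobiSym_of_square_mod {n Z : ℕ} (hn : n % 4 = 1) (hZ0 : Z ≠ 0) (hc : Z.Coprime n)
    (h : ∀ p : ℕ, p.Prime → p ∣ Z →
      ∃ x y : ℤ, (p : ℤ) ∣ x ^ 2 - n * y ^ 2 ∧ ¬ ((p : ℤ) ∣ x ∧ (p : ℤ) ∣ y)) :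
    (Z % 2 = 1 → J(Z | n) = 1) ∧ (Z % 4 = 2 → J(Z | n) = J(2 | n)) ∧
      (J(2 | n) = 1 → J(Z | n) = 1) := by
  obtain ⟨e, W, hW, rfl⟩ := Nat.exists_eq_two_pow_mul_odd hZ0
  have hWn : J(W | n) = 1 := by
    rw [jacobiSym.quadratic_reciprocity_one_mod_four' hW hn]
    refine jacobiSym_eq_one ?_ fun p hp hpW => h p hp (hpW.mul_left _)
    rw [Int.gcd_natCast_natCast]
    exact (Nat.Coprime.coprime_mul_left hc).symm
  have hJ : J((2 ^ e * W : ℕ) | n) = J(2 | n) ^ e := by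
    push_cast
    rw [jacobiSym.mul_left, jacobiSym.pow_left, hWn, mul_one]
  have hWo := Nat.odd_iff.1 hW
  rw [hJ]
  refine ⟨fun h1 => ?_, fun h1 => ?_, fun h1 => by rw [h1, one_pow]⟩
  · rcases e with _ | e
    · simp
    · rw [pow_succ, mul_right_comm] at h1
      omega
  · rcases e with _ | _ | e
    · omega
    · simp
    · rw [pow_add, pow_add] at h1
      have : (2 ^ e * 2 ^ 1 * 2 ^ 1 * W) % 4 = 0 := by
        rw [show 2 ^ e * 2 ^ 1 * 2 ^ 1 * W = 4 * (2 ^ e * W) by ring]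
        simp
      omega

/-- Divisibility by a prime, transported from `ℕ` to `ℤ` for coprime numbers. -/
lemma not_intCast_dvd_of_coprime {p A B : ℕ} (hp : p.Prime) (h : A.Coprime B) (hA : p ∣ A) :
    ¬ (p : ℤ) ∣ B := fun hB =>
  Nat.not_coprime_of_dvd_of_dvd hp.one_lt hA (Int.natCast_dvd_natCast.1 hB) h

lemma form_sub_mod_four {X z a b u v : ℤ}
    (hN : (X * (u ^ 2 + v ^ 2) + 2 * z * (a * (u ^ 2 - v ^ 2) + 2 * b * u * v)) % 2 = 1) :
    (X * (u ^ 2 + v ^ 2) + 2 * z * (a * (u ^ 2 - v ^ 2) + 2 * b * u * v) - (X + 2 * z * a)) % 4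
      = 0 := by
  have not_even : ∀ w : ℤ,
      X * (u ^ 2 + v ^ 2) + 2 * z * (a * (u ^ 2 - v ^ 2) + 2 * b * u * v) ≠ 2 * w := by
    intro w hw
    omega
  rcases Int.even_or_odd' u with ⟨s, rfl | rfl⟩ <;> rcases Int.even_or_odd' v with ⟨t, rfl | rfl⟩
  · exact absurd (by ring) (not_even (X * (2 * s ^ 2 + 2 * t ^ 2) +
      z * (a * ((2 * s) ^ 2 - (2 * t) ^ 2) + 2 * b * (2 * s) * (2 * t))))
  · exact Int.emod_eq_zero_of_dvd ⟨X * (s ^ 2 + t ^ 2 + t) + 2 * z * a * (s ^ 2 - t ^ 2 - t) - z * a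
      + z * b * (2 * s) * (2 * t + 1), by ring⟩
  · exact Int.emod_eq_zero_of_dvd ⟨X * (s ^ 2 + s + t ^ 2) + 2 * z * a * (s ^ 2 + s - t ^ 2)
      + z * b * (2 * s + 1) * (2 * t), by ring⟩
  · exact absurd (by ring) (not_even (X * (2 * s ^ 2 + 2 * s + 2 * t ^ 2 + 2 * t + 1) +
      z * (a * ((2 * s + 1) ^ 2 - (2 * t + 1) ^ 2) + 2 * b * (2 * s + 1) * (2 * t + 1))))

/-- The form `(X + aZ)u² + 2bZuv + (X - aZ)v²` primitively represents a number prime to `2nY`. -/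
lemma exists_coprime_form_value {n X Y Z : ℕ} (a b : ℤ) (hn0 : n ≠ 0)
    (hX : X % 2 = 1) (hY : Y % 2 = 1) (hZ : Z % 2 = 0)
    (hXY : X.Coprime Y) (hXn : X.Coprime n) :
    ∃ u v : ℤ, IsCoprime u v ∧ ∀ p : ℕ, p.Prime → p ∣ 2 * (n * Y) →
      ¬ (p : ℤ) ∣ (X + a * Z) * u ^ 2 + 2 * b * Z * u * v + (X - a * Z) * v ^ 2 := by
  have hY0 : Y ≠ 0 := by rintro rfl; omega
  have hK0 : 2 * (n * Y) ≠ 0 := by positivity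
  set A : ℤ := X + a * Z with hA
  set C : ℤ := X - a * Z with hC
  classical
  obtain ⟨u, hu⟩ := exists_dvd_sub_of_primes (2 * (n * Y)).primeFactors
    (fun p hp => Nat.prime_of_mem_primeFactors hp) (fun p => if (p : ℤ) ∣ A then 0 else 1)
  obtain ⟨v, hv⟩ := exists_dvd_sub_of_primes (2 * (n * Y)).primeFactors
    (fun p hp => Nat.prime_of_mem_primeFactors hp) (fun p => if (p : ℤ) ∣ A then 1 else 0)
  have hZe : (Z : ℤ) % 2 = 0 := by omega
  have hXo : (X : ℤ) % 2 = 1 := by omega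
  have key : ∀ p : ℕ, p.Prime → p ∣ 2 * (n * Y) →
      ¬ (p : ℤ) ∣ A * u ^ 2 + 2 * b * Z * u * v + C * v ^ 2 := by
    intro p hp hpK hdvd
    have hmem : p ∈ (2 * (n * Y)).primeFactors := Nat.mem_primeFactors.2 ⟨hp, hpK, hK0⟩
    have hpZ : Prime (p : ℤ) := Nat.prime_iff_prime_int.1 hp
    have hu' := hu p hmem
    have hv' := hv p hmem
    by_cases hpA : (p : ℤ) ∣ A
    · simp only [hpA, if_true, sub_zero] at hu' hv'
      have h1 : (p : ℤ) ∣ C := by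
        have e : C = (A * u ^ 2 + 2 * b * Z * u * v + C * v ^ 2) - u * (A * u + 2 * b * Z * v)
          - (v - 1) * (C * (v + 1)) := by ring
        rw [e]
        exact dvd_sub (dvd_sub hdvd (hu'.mul_right _)) (hv'.mul_right _)
      have h2 : (p : ℤ) ∣ 2 * X := by
        have e : (2 * X : ℤ) = A + C := by rw [hA, hC]; ring
        rw [e]; exact dvd_add hpA h1
      rcases hpZ.dvd_or_dvd h2 with h3 | h3
      · have hp2 : p = 2 := (Nat.prime_dvd_prime_iff_eq hp Nat.prime_two).1 (by exact_mod_cast h3)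
        subst hp2
        have : (a * Z) % 2 = 0 := by rw [Int.mul_emod, hZe]; simp
        have : A % 2 = 0 := Int.emod_eq_zero_of_dvd hpA
        omega
      · have h4 : p ∣ X := by exact_mod_cast h3
        rcases hp.dvd_mul.1 hpK with h5 | h5
        · have hp2 : p = 2 := (Nat.prime_dvd_prime_iff_eq hp Nat.prime_two).1 h5
          subst hp2
          omega
        · rcases hp.dvd_mul.1 h5 with h6 | h6
          · exact Nat.not_coprime_of_dvd_of_dvd hp.one_lt h4 h6 hXn
          · exact Nat.not_coprime_of_dvd_of_dvd hp.one_lt h4 h6 hXY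
    · simp only [hpA, if_false, sub_zero] at hu' hv'
      apply hpA
      have e : A = (A * u ^ 2 + 2 * b * Z * u * v + C * v ^ 2) - v * (2 * b * Z * u + C * v)
          - (u - 1) * (A * (u + 1)) := by ring
      rw [e]
      exact dvd_sub (dvd_sub hdvd (hv'.mul_right _)) (hu'.mul_right _)
  -- remove the common factor of `u` and `v`
  have huv : u ≠ 0 ∨ v ≠ 0 := by
    by_contra! hcon
    apply key 2 Nat.prime_two (dvd_mul_right _ _)
    rw [hcon.1, hcon.2]; simp
  obtain ⟨u', v', g, hprim, rfl, rfl⟩ :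
      ∃ u' v' g : ℤ, IsCoprime u' v' ∧ u = g * u' ∧ v = g * v' := by
    have hg : Int.gcd u v ≠ 0 := by
      rw [Ne, Int.gcd_eq_zero_iff]; tauto
    obtain ⟨u', v', hc, h1, h2⟩ := Int.exists_gcd_one (Nat.pos_of_ne_zero hg)
    exact ⟨u', v', Int.gcd u v, Int.isCoprime_iff_gcd_eq_one.2 hc, by rw [mul_comm]; exact h1,
      by rw [mul_comm]; exact h2⟩
  refine ⟨u', v', hprim, fun p hp hpK hd => key p hp hpK ?_⟩
  have e : A * (g * u') ^ 2 + 2 * b * Z * (g * u') * (g * v') + C * (g * v') ^ 2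
      = (A * u' ^ 2 + 2 * b * Z * u' * v' + C * v' ^ 2) * g ^ 2 := by ring
  rw [e]
  exact hd.mul_right _

/-- A value, prime to `2nY`, of the form `(X + aZ)u² + 2bZuv + (X - aZ)v²` of determinant `nY²`. -/
lemma exists_form_value {n X Y Z : ℕ} {a b : ℤ}
    (h : (X : ℤ) ^ 2 = (a ^ 2 + b ^ 2) * Z ^ 2 + n * Y ^ 2) (hn0 : n ≠ 0)
    (hX : X % 2 = 1) (hY : Y % 2 = 1) (hZ : Z % 2 = 0)
    (hXY : X.Coprime Y) (hXn : X.Coprime n) :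
    ∃ (N : ℕ) (u v : ℤ),
      (N : ℤ) = X * (u ^ 2 + v ^ 2) + Z * (a * (u ^ 2 - v ^ 2) + 2 * b * u * v) ∧
      N % 2 = 1 ∧ ((N : ℤ) - (X + Z * a)) % 4 = 0 ∧ N.Coprime n ∧ J(-n | N) = 1 := by
  have hY0 : Y ≠ 0 := by rintro rfl; omega
  obtain ⟨u', v', hprim, key'⟩ := exists_coprime_form_value a b hn0 hX hY hZ hXY hXn
  set A : ℤ := X + a * Z with hA
  set C : ℤ := X - a * Z with hC
  set Q : ℤ := A * u' ^ 2 + 2 * b * Z * u' * v' + C * v' ^ 2 with hQ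
  have hdet : A * C - (b * Z) ^ 2 = n * Y ^ 2 := by
    rw [hA, hC]; linear_combination h
  have id1 : (A * u' + b * Z * v') ^ 2 + n * (Y * v') ^ 2 = Q * A := by
    rw [hQ]; linear_combination (-v' ^ 2) * hdet
  have id2 : (C * v' + b * Z * u') ^ 2 + n * (Y * u') ^ 2 = Q * C := by
    rw [hQ]; linear_combination (-u' ^ 2) * hdet
  have hnY : (0 : ℤ) < n * Y ^ 2 := by positivity
  have hQpos : 0 < Q := by
    have hACpos : 0 < A * C := by linarith [sq_nonneg (b * Z)]
    have hsum : 0 < A + C := by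
      have : X ≠ 0 := by rintro rfl; omega
      have e : A + C = 2 * X := by rw [hA, hC]; ring
      rw [e]; positivity
    have e : Q * (A + C) = (A * u' + b * Z * v') ^ 2 + (C * v' + b * Z * u') ^ 2 +
        n * Y ^ 2 * (u' ^ 2 + v' ^ 2) := by linear_combination - id1 - id2
    have huv : 0 < u' ^ 2 + v' ^ 2 :=
      lt_of_le_of_ne (by positivity) hprim.sq_add_sq_ne_zero.symm
    have : 0 < Q * (A + C) := by rw [e]; positivity
    exact (pos_iff_pos_of_mul_pos this).2 hsum
  lift Q to ℕ using hQpos.le with N hN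
  have hform : (N : ℤ) = X * (u' ^ 2 + v' ^ 2) + Z * (a * (u' ^ 2 - v' ^ 2) + 2 * b * u' * v') := by
    rw [hQ, hA, hC]; ring
  have hNodd : N % 2 = 1 := by
    have := key' 2 Nat.prime_two (dvd_mul_right _ _)
    omega
  refine ⟨N, u', v', hform, hNodd, ?_, ?_, ?_⟩
  · obtain ⟨z, hz⟩ : ∃ z : ℤ, (Z : ℤ) = 2 * z := ⟨Z / 2, by omega⟩
    have hNo : (N : ℤ) % 2 = 1 := by omega
    rw [hform, hz] at hNo ⊢
    exact form_sub_mod_four hNo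
  · refine Nat.coprime_of_dvd fun p hp h1 h2 => ?_
    exact key' p hp ((h2.mul_right _).mul_left _) (by exact_mod_cast h1)
  · refine jacobiSym_eq_one ?_ fun p hp hpN => ?_
    · rw [Int.gcd_comm, Int.gcd_neg, Int.gcd_natCast_natCast]
      refine Nat.coprime_of_dvd fun p hp h1 h2 => ?_
      exact key' p hp ((h2.mul_right _).mul_left _) (by exact_mod_cast h1)
    · have hpZ : Prime (p : ℤ) := Nat.prime_iff_prime_int.1 hp
      have hpN' : (p : ℤ) ∣ N := by exact_mod_cast hpN
      have hpY : ¬ (p : ℤ) ∣ Y := fun hpY =>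
        key' p hp (((by exact_mod_cast hpY : p ∣ Y).mul_left _).mul_left _) hpN'
      by_cases hpv : (p : ℤ) ∣ v'
      · have hpu : ¬ (p : ℤ) ∣ u' := fun hpu => hpZ.not_isUnit (hprim.isUnit_of_dvd' hpu hpv)
        refine ⟨C * v' + b * Z * u', Y * u', ?_, fun hh => ?_⟩
        · rw [show (C * v' + b * Z * u') ^ 2 - -(n : ℤ) * (Y * u') ^ 2 = N * C by
            linear_combination id2]
          exact hpN'.mul_right _
        · rcases hpZ.dvd_or_dvd hh.2 with h1 | h1
          exacts [hpY h1, hpu h1]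
      · refine ⟨A * u' + b * Z * v', Y * v', ?_, fun hh => ?_⟩
        · rw [show (A * u' + b * Z * v') ^ 2 - -(n : ℤ) * (Y * v') ^ 2 = N * A by
            linear_combination id1]
          exact hpN'.mul_right _
        · rcases hpZ.dvd_or_dvd hh.2 with h1 | h1
          exacts [hpY h1, hpv h1]

/-- A square root of `-1` modulo `mn` splits `n y²` as a sum of two squares along `m = a² + b²`. -/
lemma exists_sq_add_sq_cofactor {m : ℕ} (hm : Squarefree m) {k x y : ℤ}
    (hp : x ^ 2 + 1 = m * k * y ^ 2) :
    ∃ a b S T : ℤ, a ^ 2 + b ^ 2 = m ∧ a + b * x = m * S ∧ a * S + b * T = 1 ∧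
      S ^ 2 + T ^ 2 = k * y ^ 2 := by
  have hm0 : (m : ℤ) ≠ 0 := by exact_mod_cast hm.ne_zero
  obtain ⟨a, b, hab, S, hS⟩ := exists_sq_add_sq_of_dvd hm x ⟨k * y ^ 2, by rw [hp]; ring⟩
  have hT : b - a * x = m * (b * k * y ^ 2 - x * S) := by
    linear_combination (-x) * hS + b * hp
  refine ⟨a, b, S, b * k * y ^ 2 - x * S, hab, hS, ?_, ?_⟩
  · apply mul_left_cancel₀ hm0
    linear_combination hab - a * hS - b * hT
  · apply mul_left_cancel₀ (mul_ne_zero hm0 hm0)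
    linear_combination (-(a + b * x) - m * S) * hS
      - ((b - a * x) + m * (b * k * y ^ 2 - x * S)) * hT + (1 + x ^ 2) * hab + m * hp

lemma jacobiSym_two_sq (X : ℕ) (hX : X % 2 = 1) : J(2 | X) = if X ^ 2 % 16 = 1 then 1 else -1 := by
  rw [jacobiSym.at_two (Nat.odd_iff.2 hX), ZMod.χ₈_nat_eq_if_mod_eight, if_neg (by omega)]
  have : X % 16 < 16 := Nat.mod_lt _ (by norm_num)
  rw [Nat.pow_mod, ← Nat.mod_mod_of_dvd X (by norm_num : 8 ∣ 16)]
  have h2 : X % 16 % 2 = 1 := by omega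
  generalize X % 16 = r at *
  interval_cases r <;> simp_all

lemma jacobiSym_sq_eq_one_of_odd {X : ℕ} (hX : X % 2 = 1) : J(2 | X) * J(2 | X) = 1 := by
  rw [jacobiSym_two_sq X hX]; split_ifs <;> norm_num

section Main

variable {m n X Y Z : ℕ} {x y : ℤ}

lemma PrimitiveSolution.jacobiSym_mul_eq {c m' : ℕ} (h : PrimitiveSolution (c * m') n X Y Z)
    (hX : X % 2 = 1) (hY : Y % 2 = 1) (hm' : m' % 4 = 1) (hn : n % 4 = 1)
    (hc : J(c | Y) * J(c | Y) = 1) (hc' : J(c | X) * J(c | X) = 1) :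
    J(X * Y | m') * J(X | n) = J(c | X) * J(c | Y) * J(-1 | X) := by
  have heq : (X : ℤ) ^ 2 = c * m' * Z ^ 2 + n * Y ^ 2 := by exact_mod_cast h.eq
  have h1 : J((c * m' : ℕ) | Y) = 1 := by
    refine jacobiSym_eq_one ?_ fun p hp hpY => ⟨X, Z, ?_, fun hh => ?_⟩
    · rw [Int.gcd_natCast_natCast]; exact h.coprime_Ym.symm
    · push_cast
      rw [show (X : ℤ) ^ 2 - c * m' * Z ^ 2 = Y * (n * Y) by linear_combination heq]
      exact (Int.natCast_dvd_natCast.2 hpY).mul_right _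
    · exact not_intCast_dvd_of_coprime hp h.coprime_XY.symm hpY hh.1
  have h2 : J(-((c * m' : ℕ) * n) | X) = 1 := by
    refine jacobiSym_eq_one ?_ fun p hp hpX => ⟨c * m' * Z, Y, ?_, fun hh => ?_⟩
    · rw [Int.gcd_comm, Int.gcd_neg, ← Nat.cast_mul, Int.gcd_natCast_natCast]
      exact h.coprime_Xm.mul_right h.coprime_Xn
    · push_cast
      rw [show (c * m' * Z : ℤ) ^ 2 - -(c * m' * n) * Y ^ 2 = X * (X * c * m') by
        linear_combination (-(c : ℤ) * m') * heq]
      exact (Int.natCast_dvd_natCast.2 hpX).mul_right _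
    · exact not_intCast_dvd_of_coprime hp h.coprime_XY hpX hh.2
  rw [neg_eq_neg_one_mul, jacobiSym.mul_left, jacobiSym.mul_left, Nat.cast_mul,
    jacobiSym.mul_left] at h2
  rw [Nat.cast_mul, jacobiSym.mul_left] at h1
  have oX : Odd X := Nat.odd_iff.2 hX
  have oY : Odd Y := Nat.odd_iff.2 hY
  have h3 : J(-1 | X) * J(-1 | X) = 1 := by
    rw [← sq]; exact jacobiSym.sq_one (by simp)
  rw [jacobiSym.mul_left, jacobiSym.quadratic_reciprocity_one_mod_four' oX hm',
    jacobiSym.quadratic_reciprocity_one_mod_four' oY hm',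
    jacobiSym.quadratic_reciprocity_one_mod_four' oX hn]
  have e1 : J(m' | Y) = J(c | Y) := by linear_combination J(c | Y) * h1 - J(m' | Y) * hc
  have e2 : J(m' | X) * J(n | X) = J(c | X) * J(-1 | X) := by
    linear_combination J(c | X) * J(-1 | X) * h2 - J(m' | X) * J(n | X) * hc'
      - J(m' | X) * J(n | X) * J(c | X) * J(c | X) * h3
  linear_combination J(m' | X) * J(n | X) * e1 + J(c | Y) * e2

/-- The comparison of `X` modulo `4` with the splitting of `m = a² + b²` at `n`. -/
lemma PrimitiveSolution.jacobiSym_relation (h : PrimitiveSolution m n X Y Z) {a b S : ℤ}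
    (hX : X % 2 = 1) (hY : Y % 2 = 1) (hZ : Z % 2 = 0) (hn : n % 4 = 1) (hmn : m.Coprime n)
    (hx : (n : ℤ) ∣ x ^ 2 + 1) (hab : a ^ 2 + b ^ 2 = m) (hS : a + b * x = m * S)
    (hSn : S.gcd n = 1) :
    ∃ N : ℕ, N % 2 = 1 ∧ ((N : ℤ) - (X + Z * a)) % 4 = 0 ∧
      J(2 | n) * J(Z | n) * J(S | n) * J(-1 | N) = 1 := by
  have heq : (X : ℤ) ^ 2 = m * Z ^ 2 + n * Y ^ 2 := by exact_mod_cast h.eq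
  have hn0 : n ≠ 0 := by rintro rfl; omega
  have on : Odd n := Nat.odd_iff.2 (by omega)
  obtain ⟨N, u, v, hN, hN2, hN4, hNn, hJ⟩ := exists_form_value (a := a) (b := b)
    (by rw [hab]; exact heq) hn0 hX hY hZ h.coprime_XY h.coprime_Xn
  refine ⟨N, hN2, hN4, ?_⟩
  have hmJ : J(m | n) = 1 := by
    refine jacobiSym_eq_one (by rw [Int.gcd_natCast_natCast]; exact hmn) fun p hp hpn =>
      ⟨X, Z, ?_, fun hh => ?_⟩
    · rw [show (X : ℤ) ^ 2 - m * Z ^ 2 = n * Y ^ 2 by linear_combination heq]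
      exact (Int.natCast_dvd_natCast.2 hpn).mul_right _
    · exact not_intCast_dvd_of_coprime hp h.coprime_Xn.symm hpn hh.1
  have hNJ : J(N | n) = J(-1 | N) := by
    rw [jacobiSym.quadratic_reciprocity_one_mod_four' (Nat.odd_iff.2 hN2) hn]
    rw [neg_eq_neg_one_mul, jacobiSym.mul_left] at hJ
    have h3 : J(-1 | N) * J(-1 | N) = 1 := by
      rw [← sq]; exact jacobiSym.sq_one (by simp)
    linear_combination J(-1 | N) * hJ - J(n | N) * h3
  have hprod : J(2 * Z * (m * S) * N | n) = 1 := by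
    have hdvd : (n : ℤ) ∣ ((X + m * S * Z) * u + x * (X - m * S * Z) * v) ^ 2
        - 2 * Z * (m * S) * N := by
      obtain ⟨k, hk⟩ := hx
      rw [← hS, hN]
      refine ⟨(Y ^ 2 + b ^ 2 * k * Z ^ 2) * (u ^ 2 - v ^ 2 + 2 * x * u * v) +
        k * ((X - (a + b * x) * Z) ^ 2 * v ^ 2 - 4 * (a + b * x) * b * Z ^ 2 * u * v), ?_⟩
      linear_combination (u ^ 2 - v ^ 2 + 2 * x * u * v) * heq
        - Z ^ 2 * (u ^ 2 - v ^ 2 + 2 * x * u * v) * hab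
        + (b ^ 2 * Z ^ 2 * (u ^ 2 - v ^ 2 + 2 * x * u * v) +
          ((X - (a + b * x) * Z) ^ 2 * v ^ 2 - 4 * (a + b * x) * b * Z ^ 2 * u * v)) * hk
    have hcop : (2 * Z * (m * S) * N : ℤ).gcd n = 1 := by
      rw [← Int.isCoprime_iff_gcd_eq_one] at hSn ⊢
      have c2 : IsCoprime (2 : ℤ) n := by
        exact_mod_cast Nat.isCoprime_iff_coprime.2 (Nat.coprime_two_left.2 on)
      exact ((c2.mul_left (Nat.isCoprime_iff_coprime.2 h.coprime_Zn)).mul_left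
        ((Nat.isCoprime_iff_coprime.2 hmn).mul_left hSn)).mul_left
        (Nat.isCoprime_iff_coprime.2 hNn)
    refine jacobiSym_eq_one hcop fun p hp hpn =>
      ⟨(X + m * S * Z) * u + x * (X - m * S * Z) * v, 1, ?_, fun hh => ?_⟩
    · rw [one_pow, mul_one]
      exact (Int.natCast_dvd_natCast.2 hpn).trans hdvd
    · exact hp.one_lt.ne' (Nat.dvd_one.1 (by exact_mod_cast hh.2))
  rw [jacobiSym.mul_left, jacobiSym.mul_left, jacobiSym.mul_left, jacobiSym.mul_left, hmJ,
    hNJ] at hprod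
  linear_combination hprod

end Main

lemma jacobiSym_neg_one_nat (N : ℕ) (hN : N % 2 = 1) :
    J(-1 | N) = if N % 4 = 1 then 1 else -1 := by
  rw [jacobiSym.at_neg_one (Nat.odd_iff.2 hN), ZMod.χ₄_nat_eq_if_mod_four, if_neg (by omega)]

lemma jacobiSym_two_of_mod_four {n : ℕ} (hn : n % 4 = 1) :
    J(2 | n) = if n % 8 = 1 then 1 else -1 := by
  rw [jacobiSym.at_two (Nat.odd_iff.2 (by omega)), ZMod.χ₈_nat_eq_if_mod_eight,
    if_neg (by omega)]
  split_ifs <;> omega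

lemma sq_emod_eight_of_odd {t : ℤ} (ht : t % 2 = 1) : t ^ 2 % 8 = 1 := by
  obtain ⟨k, rfl⟩ : ∃ k, t = 2 * k + 1 := ⟨t / 2, by omega⟩
  have h : k * (k + 1) % 2 = 0 := Int.even_iff.1 (Int.even_mul_succ_self k)
  have e : (2 * k + 1) ^ 2 = 4 * (k * (k + 1)) + 1 := by ring
  omega

lemma exists_sq_eq_add_two_mul (z : ℤ) : ∃ i : ℤ, z ^ 2 = z + 2 * i := by
  obtain ⟨i, hi⟩ := (Int.even_mul_succ_self (z - 1)).two_dvd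
  exact ⟨i, by linear_combination hi⟩

lemma exists_sq_eq_of_odd {t : ℤ} (ht : t % 2 = 1) : ∃ j : ℤ, t ^ 2 = 8 * j + 1 := by
  have := sq_emod_eight_of_odd ht
  exact ⟨t ^ 2 / 8, by omega⟩

lemma mul_sq_emod_sixteen {m n X Y z : ℤ} (hm : m % 2 = 1) (hY : Y % 2 = 1)
    (h : X ^ 2 = 8 * (m * z ^ 2) + n * Y ^ 2) : (X * Y) ^ 2 % 16 = (8 * z + n) % 16 := by
  obtain ⟨j, hj⟩ := exists_sq_eq_of_odd hY
  obtain ⟨i, hi⟩ := exists_sq_eq_add_two_mul z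
  obtain ⟨k, rfl⟩ : ∃ k, m = 2 * k + 1 := ⟨m / 2, by omega⟩
  have e : (X * Y) ^ 2 = 8 * z + n + 16 * (i + 4 * j * (z + 2 * i) +
      k * (z + 2 * i) * (8 * j + 1) + n * (4 * j ^ 2 + j)) := by
    rw [mul_pow, h, hj, hi]; ring
  omega

lemma four_mul_add_emod_eight {m n X Y z : ℤ} (hm : m % 2 = 1) (hX : X % 2 = 1) (hY : Y % 2 = 1)
    (h : X ^ 2 = 4 * (m * z ^ 2) + n * Y ^ 2) : (4 * z + n) % 8 = 1 := by
  obtain ⟨j, hj⟩ := exists_sq_eq_of_odd hY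
  obtain ⟨j', hj'⟩ := exists_sq_eq_of_odd hX
  obtain ⟨i, hi⟩ := exists_sq_eq_add_two_mul z
  obtain ⟨k, rfl⟩ : ∃ k, m = 2 * k + 1 := ⟨m / 2, by omega⟩
  have e : 4 * z + n = 8 * (j' - i - k * (z + 2 * i) - n * j) + 1 := by
    rw [hi, hj, hj'] at h
    linear_combination -h
  omega

lemma emod_two_eq_one_of_sq_add_sq {a b m : ℤ} (h : a ^ 2 + b ^ 2 = 2 * m) (hm : m % 2 = 1) :
    a % 2 = 1 := by
  by_contra ha
  obtain ⟨k, rfl⟩ : ∃ k, a = 2 * k := ⟨a / 2, by omega⟩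
  rcases Int.even_or_odd' b with ⟨t, rfl | rfl⟩
  · have : 2 * (k ^ 2 + t ^ 2) = m := by linarith
    omega
  · have : 2 * (2 * (k ^ 2 + t ^ 2 + t)) + 1 = 2 * m := by linarith
    omega

/-- The `2`-adic behaviour of `S` in `S² + T² = ny²`, in terms of `a` with `aS + bT = 1`. -/
lemma emod_of_sq_add_sq_eq {m n a b S T x y : ℤ} (hm : m % 2 = 1)
    (hab : a ^ 2 + b ^ 2 = m) (hST : a * S + b * T = 1) (hSTn : S ^ 2 + T ^ 2 = n * y ^ 2)
    (hp : x ^ 2 + 1 = m * n * y ^ 2) :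
    (a % 2 = 1 → S % 2 = 1) ∧ (a % 2 = 0 → n % 8 = 5 → S % 4 = 2) := by
  constructor
  · intro ha
    obtain ⟨k, rfl⟩ : ∃ k, a = 2 * k + 1 := ⟨a / 2, by omega⟩
    rcases Int.even_or_odd' b with ⟨t, rfl | rfl⟩
    · have : S = 2 * (- k * S - t * T) + 1 := by linear_combination hST
      omega
    · have : m = 2 * (2 * k ^ 2 + 2 * k + 2 * t ^ 2 + 2 * t + 1) := by linear_combination -hab
      omega
  · intro ha hn
    obtain ⟨k, rfl⟩ : ∃ k, a = 2 * k := ⟨a / 2, by omega⟩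
    have hT : T % 2 = 1 := by
      by_contra hT
      obtain ⟨t, rfl⟩ : ∃ t, T = 2 * t := ⟨T / 2, by omega⟩
      have : 2 * (k * S + b * t) = 1 := by linear_combination hST
      omega
    have hy : y % 2 = 1 := by
      by_contra hy
      obtain ⟨w, rfl⟩ : ∃ w, y = 2 * w := ⟨y / 2, by omega⟩
      rcases Int.even_or_odd' x with ⟨t, rfl | rfl⟩
      · have : 4 * (m * n * w ^ 2 - t ^ 2) = 1 := by linear_combination -hp
        omega
      · have : 4 * (m * n * w ^ 2 - t ^ 2 - t) = 2 := by linear_combination -hp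
        omega
    obtain ⟨j, hj⟩ := exists_sq_eq_of_odd hT
    obtain ⟨j', hj'⟩ := exists_sq_eq_of_odd hy
    rw [hj, hj'] at hSTn
    have hS : S ^ 2 = 8 * (n * j' - j) + n - 1 := by linear_combination hSTn
    rcases Int.even_or_odd' S with ⟨s, rfl | rfl⟩
    · rcases Int.even_or_odd' s with ⟨t, rfl | rfl⟩
      · have : 8 * (2 * t ^ 2) = 8 * (n * j' - j) + n - 1 := by linear_combination hS
        omega
      · omega
    · have : 2 * (2 * s ^ 2 + 2 * s) + 1 = 8 * (n * j' - j) + n - 1 := by linear_combination hS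
      omega

/-- The quartic symbols modulo the odd primes dividing `n` multiply to a Jacobi symbol. -/
lemma prod_quartSym_eq_jacobiSym {n : ℕ} (hn : Squarefree n) (hn2 : n % 2 = 1) {a X Z x : ℤ}
    (hx : (n : ℤ) ∣ x ^ 2 + 1) (h : (n : ℤ) ∣ X ^ 2 - a * Z ^ 2)
    (hX : IsCoprime (n : ℤ) X) (hZ : IsCoprime (n : ℤ) Z) :
    ∏ q ∈ n.primeFactors, quartSym a q = J(X * Z | n) := by
  rw [jacobiSym_eq_prod_primeFactors _ hn]
  refine Finset.prod_congr rfl fun q hq => ?_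
  have hqp := Nat.prime_of_mem_primeFactors hq
  have hqn : (q : ℤ) ∣ n := Int.natCast_dvd_natCast.2 (Nat.dvd_of_mem_primeFactors hq)
  have hqZ : Prime (q : ℤ) := Nat.prime_iff_prime_int.1 hqp
  refine quartSym_eq_jacobiSym hqp ?_ (hqn.trans hx) (hqn.trans h)
    (fun hd => hqZ.not_isUnit (hX.isUnit_of_dvd' hqn hd))
    (fun hd => hqZ.not_isUnit (hZ.isUnit_of_dvd' hqn hd))
  rintro rfl
  omega

/-- The product of the quartic symbols is `1` when the negative Pell equation is solvable. -/
lemma PrimitiveSolution.prod_quartSym_eq_one {m n X Y Z : ℕ} {x y : ℤ}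
    (h : PrimitiveSolution m n X Y Z) (hm : Squarefree m) (hn : Squarefree n) (hn1 : 1 < n)
    (hmn : m.Coprime n) (hn2 : n % 2 = 1) (hZ : Z % 2 = 0) (hn8 : m % 2 = 0 → n % 8 = 1)
    (hp : x ^ 2 + 1 = m * n * y ^ 2) :
    (∏ p ∈ m.primeFactors, quartSym (n : ℤ) p) * (∏ q ∈ n.primeFactors, quartSym (m : ℤ) q)
      = 1 := by
  have heq : (X : ℤ) ^ 2 = m * Z ^ 2 + n * Y ^ 2 := by exact_mod_cast h.eq
  have hXo : X % 2 = 1 := by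
    by_contra hX
    exact Nat.not_coprime_of_dvd_of_dvd one_lt_two (Nat.dvd_of_mod_eq_zero (by omega))
      (Nat.dvd_of_mod_eq_zero hZ) h.coprime_XZ
  have hX8 : (X : ℤ) ^ 2 % 8 = 1 := sq_emod_eight_of_odd (by omega)
  obtain ⟨z, hz⟩ : ∃ z : ℕ, Z = 2 * z := ⟨Z / 2, by omega⟩
  have heq' : (X : ℤ) ^ 2 = 4 * (m * z ^ 2) + n * Y ^ 2 := by
    rw [heq, hz]; push_cast; ring
  have hYo : Y % 2 = 1 := by
    by_contra hY
    obtain ⟨w, hw⟩ : ∃ w : ℕ, Y = 2 * w := ⟨Y / 2, by omega⟩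
    have : (X : ℤ) ^ 2 = 4 * (m * z ^ 2 + n * w ^ 2) := by
      rw [heq', hw]; push_cast; ring
    omega
  have hY8 : (Y : ℤ) ^ 2 % 8 = 1 := sq_emod_eight_of_odd (by omega)
  have hxm : (m : ℤ) ∣ x ^ 2 + 1 := ⟨n * y ^ 2, by rw [hp]; ring⟩
  have hxn : (n : ℤ) ∣ x ^ 2 + 1 := ⟨m * y ^ 2, by rw [hp]; ring⟩
  have hn4 : n % 4 = 1 := mod_four_eq_one_of_dvd (Nat.odd_iff.2 hn2) hxn
  obtain ⟨a, b, S, T, hab, hS, hST, hSTn⟩ := exists_sq_add_sq_cofactor hm hp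
  have hcopST : IsCoprime S T := ⟨a, b, hST⟩
  have hZ0 : Z ≠ 0 := by
    rintro rfl
    have := h.coprime_Zn
    rw [Nat.coprime_zero_left] at this
    omega
  have hSprime : ∀ p : ℕ, p.Prime → (p : ℤ) ∣ S → (p : ℤ) ∣ n * y ^ 2 → False := by
    intro p hp hpS hpn
    have hpZ : Prime (p : ℤ) := Nat.prime_iff_prime_int.1 hp
    have hT : (p : ℤ) ∣ T ^ 2 := by
      rw [show T ^ 2 = n * y ^ 2 - S * S by linear_combination hSTn]
      exact dvd_sub hpn (hpS.mul_right _)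
    exact hpZ.not_isUnit (hcopST.isUnit_of_dvd' hpS (hpZ.dvd_of_dvd_pow hT))
  have hSn : S.gcd n = 1 := by
    rw [Int.gcd_def]
    refine Nat.coprime_of_dvd fun p hp h1 h2 => ?_
    exact hSprime p hp (Int.natCast_dvd.2 h1) ((Int.natCast_dvd.2 h2).mul_right _)
  have hS0 : S ≠ 0 := by
    rintro rfl
    simp at hSn
    omega
  have hJS : J(S | n) = J(S.natAbs | n) := by
    rcases Int.natAbs_eq S with h1 | h1
    · rw [← h1]
    · conv_lhs => rw [h1]
      rw [neg_eq_neg_one_mul, jacobiSym.mul_left, jacobiSym_neg_one_nat n hn2, if_pos hn4, one_mul]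
  obtain ⟨S1, S2, S3⟩ := jacobiSym_of_square_mod (Z := S.natAbs) hn4 (Int.natAbs_ne_zero.2 hS0)
    (by simpa [Int.gcd_def] using hSn) (fun p hp hpS => by
      have hpS' : (p : ℤ) ∣ S := Int.natCast_dvd.2 hpS
      refine ⟨T, y, ?_, fun hh => ?_⟩
      · rw [show T ^ 2 - n * y ^ 2 = S * (-S) by linear_combination hSTn]
        exact hpS'.mul_right _
      · exact hSprime p hp hpS' ((dvd_pow hh.2 two_ne_zero).mul_left _))
  obtain ⟨-, Z2, Z3⟩ := jacobiSym_of_square_mod hn4 hZ0 h.coprime_Zn (fun p hp hpZ => by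
      refine ⟨X, Y, ?_, fun hh => ?_⟩
      · rw [show (X : ℤ) ^ 2 - n * Y ^ 2 = Z * (m * Z) by linear_combination heq]
        exact (Int.natCast_dvd_natCast.2 hpZ).mul_right _
      · exact not_intCast_dvd_of_coprime hp h.coprime_XZ.symm hpZ hh.1)
  obtain ⟨N, hN2, hN4, hrel⟩ :=
    h.jacobiSym_relation hXo hYo hZ hn4 hmn hxn hab hS hSn
  rw [hJS] at hrel
  have hX1 := jacobiSym_neg_one_nat X hXo
  have hNeg := jacobiSym_neg_one_nat N hN2
  have hJ2 := jacobiSym_two_of_mod_four hn4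
  have hprodn : ∏ q ∈ n.primeFactors, quartSym (m : ℤ) q = J(X | n) * J(Z | n) := by
    rw [← jacobiSym.mul_left]
    exact prod_quartSym_eq_jacobiSym hn hn2 hxn ⟨Y ^ 2, by linear_combination heq⟩
      (Nat.isCoprime_iff_coprime.2 h.coprime_Xn.symm)
      (Nat.isCoprime_iff_coprime.2 h.coprime_Zn.symm)
  rw [hprodn]
  rcases Nat.mod_two_eq_zero_or_one m with hm2 | hm2
  · -- `m` is even
    have hn8' := hn8 hm2
    obtain ⟨m', rfl⟩ : ∃ m', m = 2 * m' := ⟨m / 2, by omega⟩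
    have hm'o : m' % 2 = 1 := by
      by_contra hcon
      have := hm 2 (mul_dvd_mul_left 2 (Nat.dvd_of_mod_eq_zero (by omega)))
      simp at this
    have hm'sq : Squarefree m' := hm.squarefree_of_dvd (dvd_mul_left _ _)
    have hxm' : (m' : ℤ) ∣ x ^ 2 + 1 :=
      (Int.natCast_dvd_natCast.2 (dvd_mul_left m' 2)).trans hxm
    have hm'4 : m' % 4 = 1 := mod_four_eq_one_of_dvd (Nat.odd_iff.2 hm'o) hxm'
    have hm'0 : m' ≠ 0 := by omega
    have hpf : (2 * m').primeFactors = insert 2 m'.primeFactors := by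
      rw [Nat.primeFactors_mul two_ne_zero hm'0, Nat.prime_two.primeFactors]
      rfl
    have h2nm : 2 ∉ m'.primeFactors := fun hh => by
      have := Nat.dvd_of_mem_primeFactors hh
      omega
    have hprodm : ∏ p ∈ m'.primeFactors, quartSym (n : ℤ) p = J(X * Y | m') := by
      refine prod_quartSym_eq_jacobiSym hm'sq hm'o hxm'
        ⟨2 * Z ^ 2, by push_cast at heq; linear_combination heq⟩
        (Nat.isCoprime_iff_coprime.2 ?_) (Nat.isCoprime_iff_coprime.2 ?_)
      · exact (Nat.Coprime.coprime_mul_left_right h.coprime_Xm).symm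
      · exact (Nat.Coprime.coprime_mul_left_right h.coprime_Ym).symm
    have hXYJ := h.jacobiSym_mul_eq hXo hYo hm'4 hn4 (jacobiSym_sq_eq_one_of_odd hYo)
      (jacobiSym_sq_eq_one_of_odd hXo)
    rw [hpf, Finset.prod_insert h2nm, hprodm]
    rw [if_pos hn8'] at hJ2
    rw [hJ2, Z3 hJ2, S3 hJ2] at hrel
    rw [Z3 hJ2]
    have hquart2 : quartSym (n : ℤ) 2 = if n % 16 = 1 then 1 else -1 := by
      rw [quartSym, if_pos rfl]
      split_ifs <;> omega
    have hXY2 : J(2 | X) * J(2 | Y) = J(2 | X * Y) := by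
      rw [jacobiSym.mul_right' _ (by omega) (by omega)]
    have hXYo : X * Y % 2 = 1 := by rw [Nat.mul_mod, hXo, hYo]
    rw [jacobiSym_two_sq _ hXYo] at hXY2
    have h16 : (X * Y) ^ 2 % 16 = (8 * z + n) % 16 := by
      have := mul_sq_emod_sixteen (m := m') (n := n) (X := X) (Y := Y) (z := z) (by omega)
        (by omega) (by push_cast at heq'; linear_combination heq')
      exact_mod_cast this
    obtain ⟨k, hk⟩ : ∃ k, a = 2 * k + 1 := ⟨a / 2, by
      have := emod_two_eq_one_of_sq_add_sq (m := m') (by rw [hab]; push_cast; ring) (by omega)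
      omega⟩
    have hZa : (Z * a : ℤ) = 4 * (z * k) + 2 * z := by rw [hz, hk]; push_cast; ring
    rw [hZa] at hN4
    have hN1 : N % 4 = 1 := by
      by_contra hcon
      rw [hNeg, if_neg hcon] at hrel
      norm_num at hrel
    have hgoal : quartSym (n : ℤ) 2 * J(X * Y | m') * (J(X | n) * 1)
        = quartSym (n : ℤ) 2 * ((J(2 | X) * J(2 | Y)) * J(-1 | X)) := by
      push_cast at hXYJ
      linear_combination quartSym (n : ℤ) 2 * hXYJ
    rw [hgoal, hXY2, hX1, hquart2, h16]
    rcases Nat.mod_two_eq_zero_or_one z with hz2 | hz2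
    · have e1 : (8 * z + n) % 16 = n % 16 := by omega
      have e2 : X % 4 = 1 := by omega
      rw [e1, if_pos e2]
      split_ifs <;> norm_num
    · have e2 : ¬ X % 4 = 1 := by omega
      rw [if_neg e2]
      split_ifs <;> omega
  · -- `m` is odd
    have hm4 : m % 4 = 1 := mod_four_eq_one_of_dvd (Nat.odd_iff.2 hm2) hxm
    have hprodm : ∏ p ∈ m.primeFactors, quartSym (n : ℤ) p = J(X * Y | m) :=
      prod_quartSym_eq_jacobiSym hm hm2 hxm ⟨Z ^ 2, by linear_combination heq⟩
        (Nat.isCoprime_iff_coprime.2 h.coprime_Xm.symm)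
        (Nat.isCoprime_iff_coprime.2 h.coprime_Ym.symm)
    have h' : PrimitiveSolution (1 * m) n X Y Z := by rwa [one_mul]
    have hXYJ := h'.jacobiSym_mul_eq hXo hYo hm4 hn4 (by simp) (by simp)
    simp only [Nat.cast_one, jacobiSym.one_left, one_mul] at hXYJ
    rw [hprodm, ← mul_assoc, hXYJ]
    have h8 := four_mul_add_emod_eight (m := m) (n := n) (X := X) (Y := Y) (z := z) (by omega)
      (by omega) (by omega) heq'
    obtain ⟨Sodd, Stwo⟩ := emod_of_sq_add_sq_eq (by omega) hab hST hSTn hp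
    rcases Nat.mod_two_eq_zero_or_one z with hz2 | hz2
    · have hJ2' : J(2 | n) = 1 := by rw [hJ2, if_pos (by omega)]
      rw [hJ2', Z3 hJ2', S3 hJ2', hNeg] at hrel
      rw [Z3 hJ2', hX1]
      obtain ⟨w, hw⟩ : ∃ w, z = 2 * w := ⟨z / 2, by omega⟩
      have hZa : (Z * a : ℤ) = 4 * (w * a) := by rw [hz, hw]; push_cast; ring
      rw [hZa] at hN4
      split_ifs at hrel ⊢ <;> omega
    · have hJ2' : J(2 | n) = -1 := by rw [hJ2, if_neg (by omega)]
      have hJZ : J(Z | n) = -1 := by rw [Z2 (by omega), hJ2']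
      rw [hJ2', hJZ, hNeg] at hrel
      rw [hJZ, hX1]
      obtain ⟨w, hw⟩ : ∃ w, z = 2 * w + 1 := ⟨z / 2, by omega⟩
      rcases Int.even_or_odd' a with ⟨k, hk | hk⟩
      · have hZa : (Z * a : ℤ) = 4 * (z * k) := by rw [hz, hk]; push_cast; ring
        have hS2 := Stwo (by omega) (by omega)
        rw [hZa] at hN4
        rw [S2 (by omega), hJ2'] at hrel
        split_ifs at hrel ⊢ <;> omega
      · have hZa : (Z * a : ℤ) = 4 * (2 * w * k + w + k) + 2 := by
          rw [hz, hw, hk]; push_cast; ring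
        have hS1 := Sodd (by omega)
        rw [hZa] at hN4
        rw [S1 (by omega)] at hrel
        split_ifs at hrel ⊢ <;> omega

lemma quartSym_one (p : ℕ) : quartSym 1 p = 1 := by
  unfold quartSym
  have h : ∃ x : ℤ, (p : ℤ) ∣ x ^ 4 - 1 := ⟨1, by simp⟩
  simp [h]

lemma PrimitiveSolution.even_Z_or_even_Y {m n X Y Z : ℕ} (h : PrimitiveSolution m n X Y Z)
    (hn4 : n % 4 = 1) (hm4 : m % 4 = 1 ∨ m % 4 = 2) :
    Z % 2 = 0 ∨ (m % 2 = 1 ∧ Y % 2 = 0) := by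
  have hXm : X % 2 = 1 ∨ m % 2 = 1 := by
    by_contra! hcon
    exact Nat.not_coprime_of_dvd_of_dvd one_lt_two (Nat.dvd_of_mod_eq_zero (by omega))
      (Nat.dvd_of_mod_eq_zero (by omega)) h.coprime_Xm
  have sq (t : ℕ) : t % 2 = 0 ∧ t ^ 2 % 4 = 0 ∨ t % 2 = 1 ∧ t ^ 2 % 4 = 1 := by
    have : t % 4 = 0 ∨ t % 4 = 1 ∨ t % 4 = 2 ∨ t % 4 = 3 := by omega
    rcases this with ht | ht | ht | ht <;> simp [Nat.pow_mod, ht] <;> omega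
  have h4 : X ^ 2 % 4 = ((m % 4) * (Z ^ 2 % 4) + (n % 4) * (Y ^ 2 % 4)) % 4 := by
    rw [h.eq, Nat.add_mod, Nat.mul_mod, Nat.mul_mod n, ← Nat.add_mod]
  rcases sq X with hX | hX <;> rcases sq Y with hY | hY <;> rcases sq Z with hZ | hZ <;>
    rcases hm4 with hm4 | hm4 <;> rw [hX.2, hY.2, hZ.2, hm4, hn4] at h4 <;> omega

lemma exists_dvd_sq_sub_of_legSym {m : ℕ} (hm : Squarefree m) {a : ℤ}
    (h : ∀ p ∈ m.primeFactors, legSym a p = 1) : ∃ x : ℤ, (m : ℤ) ∣ x ^ 2 - a := by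
  refine exists_dvd_sq_sub hm a fun p hp => ?_
  have hp1 := h p hp
  unfold legSym at hp1
  split_ifs at hp1 with h1 h2 h3
  · exact ⟨1, by subst h1; omega⟩
  · exact h3

lemma mod_eight_of_legSym_two {m n : ℕ} (hm : m ≠ 0) (hm2 : m % 2 = 0) (hn4 : n % 4 = 1)
    (h : ∀ p ∈ m.primeFactors, legSym (n : ℤ) p = 1) : n % 8 = 1 := by
  have h2 := h 2 (Nat.mem_primeFactors.2 ⟨Nat.prime_two, Nat.dvd_of_mod_eq_zero hm2, hm⟩)
  rw [legSym, if_pos rfl] at h2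
  split_ifs at h2 with h3
  omega

lemma mod_four_of_squarefree {m : ℕ} (hm : Squarefree m) (hm4 : m % 2 = 1 → m % 4 = 1) :
    m % 4 = 1 ∨ m % 4 = 2 := by
  have h4 : ¬ 2 * 2 ∣ m := fun h => by simpa using hm 2 h
  omega

theorem stmt_8 (m n : ℕ) (hm : Squarefree m) (hn : Squarefree n)
    (hmn1 : 1 < m * n) (hco : Nat.Coprime m n)
    (h3 : ∀ p : ℕ, p.Prime → (p ∣ m ∨ p ∣ n) → p % 4 ≠ 3)
    (hnm : ∀ p ∈ m.primeFactors, legSym (n : ℤ) p = 1)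
    (hmq : ∀ q ∈ n.primeFactors, legSym (m : ℤ) q = 1)
    (hquart : (∏ p ∈ m.primeFactors, quartSym (n : ℤ) p) *
      (∏ q ∈ n.primeFactors, quartSym (m : ℤ) q) = -1) :
    ¬ ∃ x y : ℤ, x ^ 2 - (m * n : ℕ) * y ^ 2 = -1 := by
  rintro ⟨x, y, hxy⟩
  have hp : x ^ 2 + 1 = m * n * y ^ 2 := by push_cast at hxy; linear_combination hxy
  have hp' : x ^ 2 + 1 = n * m * y ^ 2 := by rw [hp]; ring
  have hm0 := hm.ne_zero
  have hn0 := hn.ne_zero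
  have hm1 : 1 < m := by
    by_contra hcon
    obtain rfl : m = 1 := by omega
    simp [quartSym_one] at hquart
  have hn1 : 1 < n := by
    by_contra hcon
    obtain rfl : n = 1 := by omega
    simp [quartSym_one] at hquart
  have hn4 : n % 2 = 1 → n % 4 = 1 := fun h => mod_four_eq_one_of_dvd (Nat.odd_iff.2 h)
    (x := x) ⟨m * y ^ 2, by rw [hp]; ring⟩
  have hm4 : m % 2 = 1 → m % 4 = 1 := fun h => mod_four_eq_one_of_dvd (Nat.odd_iff.2 h)
    (x := x) ⟨n * y ^ 2, by rw [hp]; ring⟩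
  obtain ⟨s, hs⟩ := exists_dvd_sq_sub_of_legSym hm hnm
  obtain ⟨t, ht⟩ := exists_dvd_sq_sub_of_legSym hn hmq
  obtain ⟨X, Y, Z, h⟩ := exists_primitiveSolution hm hn hco
    (exists_legendre_solution hm hn hco s t hs ht)
  have hodd : m % 2 = 1 ∨ n % 2 = 1 := by
    by_contra! hcon
    exact Nat.not_coprime_of_dvd_of_dvd one_lt_two (Nat.dvd_of_mod_eq_zero (by omega))
      (Nat.dvd_of_mod_eq_zero (by omega)) hco
  have hcase : (n % 2 = 1 ∧ Z % 2 = 0) ∨ (m % 2 = 1 ∧ Y % 2 = 0) := by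
    rcases Nat.mod_two_eq_zero_or_one n with hn2 | hn2
    · have hm2 : m % 2 = 1 := by omega
      have := h.swap.even_Z_or_even_Y (hm4 hm2) (mod_four_of_squarefree hn hn4)
      omega
    · have := h.even_Z_or_even_Y (hn4 hn2) (mod_four_of_squarefree hm hm4)
      omega
  rcases hcase with ⟨hn2, hZ⟩ | ⟨hm2, hY⟩
  · have := h.prod_quartSym_eq_one hm hn hn1 hco hn2 hZ
      (fun hm2 => mod_eight_of_legSym_two hm0 hm2 (hn4 hn2) hnm) hp
    omega
  · have := h.swap.prod_quartSym_eq_one hn hm hm1 hco.symm hm2 hY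
      (fun hn2 => mod_eight_of_legSym_two hn0 hn2 (hm4 hm2) hmq) hp'
    rw [mul_comm] at this
    omega
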